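/- Let k ≥ 2, let 0 < s < r < 1 with r² < s, let δ > 0, let p ∈ ℂ^k, and let (F_j)_{j ≥ 1} be a sequence of holomorphic automorphisms of ℂ^k with F_j(p) = p and s‖z − p‖ ≤ ‖F_j(z) − p‖ ≤ r‖z − p‖ for all z in the open ball B_δ(p) and all j. Then the basin of attraction Ω^p_{(F_j)} = {z ∈ ℂ^k : F_j ∘ ⋯ ∘ F_1 (z) → p as j → ∞} is biholomorphic to ℂ^k: there exists an injective holomorphic map Φ on Ω^p_{(F_j)} with Φ(Ω^p_{(F_j)}) = ℂ^k. -/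

import Mathlib

open Metric Set Filter

noncomputable section

/-- A holomorphic automorphism of `ℂ^k`: a holomorphic bijection with holomorphic inverse. -/
def IsAutomorphism {k : ℕ} (F : EuclideanSpace ℂ (Fin k) → EuclideanSpace ℂ (Fin k)) : Prop :=
  Differentiable ℂ F ∧ ∃ G : EuclideanSpace ℂ (Fin k) → EuclideanSpace ℂ (Fin k),
    Differentiable ℂ G ∧ Function.LeftInverse G F ∧ Function.RightInverse G F

/-- `seqComp F j = F j ∘ ⋯ ∘ F 1`, with `seqComp F 0 = id`. -/
def seqComp {α : Type*} (F : ℕ → α → α) : ℕ → α → α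
  | 0 => id
  | n + 1 => F (n + 1) ∘ seqComp F n

open Topology

namespace FB

variable {E : Type*} [NormedAddCommGroup E] [NormedSpace ℂ E]

/-- Normalised data: fixed point at the origin, indexing from `0`. -/
structure Good (s r δ : ℝ) (G : ℕ → E → E) (A : ℕ → E ≃L[ℂ] E) : Prop where
  diff : ∀ j, Differentiable ℂ (G j)
  zero : ∀ j, G j 0 = 0
  upper : ∀ j, ∀ z, ‖z‖ < δ → ‖G j z‖ ≤ r * ‖z‖
  deriv : ∀ j, HasFDerivAt (G j) (A j : E →L[ℂ] E) 0
  Aup : ∀ j v, ‖A j v‖ ≤ r * ‖v‖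
  Alow : ∀ j v, s * ‖v‖ ≤ ‖A j v‖

def it (G : ℕ → E → E) : ℕ → E → E
  | 0 => id
  | n + 1 => G n ∘ it G n

def L (A : ℕ → E ≃L[ℂ] E) : ℕ → (E ≃L[ℂ] E)
  | 0 => ContinuousLinearEquiv.refl ℂ E
  | n + 1 => (L A n).trans (A n)

def approx (G : ℕ → E → E) (A : ℕ → E ≃L[ℂ] E) (n : ℕ) (z : E) : E :=
  (L A n).symm (it G n z)

theorem it_add (G : ℕ → E → E) (m n : ℕ) (z : E) :
    it G (m + n) z = it (fun j => G (m + j)) n (it G m z) := by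
  induction n with
  | zero => rfl
  | succ n ih =>
    show G (m + n) (it G (m + n) z) = G (m + n) (it (fun j => G (m + j)) n (it G m z))
    rw [ih]

theorem L_add (A : ℕ → E ≃L[ℂ] E) (m n : ℕ) (z : E) :
    L A (m + n) z = L (fun j => A (m + j)) n (L A m z) := by
  induction n with
  | zero => rfl
  | succ n ih =>
    show A (m + n) (L A (m + n) z) = A (m + n) (L (fun j => A (m + j)) n (L A m z))
    rw [ih]

theorem approx_add (G : ℕ → E → E) (A : ℕ → E ≃L[ℂ] E) (m n : ℕ) (z : E) :
    approx G A (m + n) z =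
      (L A m).symm (approx (fun j => G (m + j)) (fun j => A (m + j)) n (it G m z)) := by
  unfold approx
  rw [ContinuousLinearEquiv.symm_apply_eq, L_add, ContinuousLinearEquiv.apply_symm_apply,
    ContinuousLinearEquiv.apply_symm_apply, it_add]

theorem L_low {A : ℕ → E ≃L[ℂ] E} {s : ℝ} (hs : 0 < s) (h : ∀ j v, s * ‖v‖ ≤ ‖A j v‖)
    (n : ℕ) (v : E) : s ^ n * ‖v‖ ≤ ‖L A n v‖ := by
  induction n with
  | zero => simp [L]
  | succ n ih =>
    calc s ^ (n + 1) * ‖v‖ = s * (s ^ n * ‖v‖) := by ring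
      _ ≤ s * ‖L A n v‖ := by gcongr
      _ ≤ _ := h n _

theorem L_up {A : ℕ → E ≃L[ℂ] E} {r : ℝ} (hr : 0 < r) (h : ∀ j v, ‖A j v‖ ≤ r * ‖v‖)
    (n : ℕ) (v : E) : ‖L A n v‖ ≤ r ^ n * ‖v‖ := by
  induction n with
  | zero => simp [L]
  | succ n ih =>
    calc ‖L A (n + 1) v‖ ≤ r * ‖L A n v‖ := h n _
      _ ≤ r * (r ^ n * ‖v‖) := by gcongr
      _ = _ := by ring

namespace Good

variable {s r δ : ℝ} {G : ℕ → E → E} {A : ℕ → E ≃L[ℂ] E}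

theorem shift (h : Good s r δ G A) (m : ℕ) :
    Good s r δ (fun j => G (m + j)) (fun j => A (m + j)) :=
  ⟨fun _ => h.diff _, fun _ => h.zero _, fun _ => h.upper _, fun _ => h.deriv _,
    fun _ => h.Aup _, fun _ => h.Alow _⟩

theorem it_diff (h : Good s r δ G A) (n : ℕ) : Differentiable ℂ (it G n) := by
  induction n with
  | zero => exact differentiable_id
  | succ n ih => exact (h.diff n).comp ih

theorem it_le (h : Good s r δ G A) (hr : 0 < r) (hr1 : r < 1) (n : ℕ) (z : E) (hz : ‖z‖ < δ) :
    ‖it G n z‖ ≤ r ^ n * ‖z‖ := by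
  induction n with
  | zero => simp [it]
  | succ n ih =>
    have h1 : ‖it G n z‖ < δ := by
      refine lt_of_le_of_lt (ih.trans ?_) hz
      exact mul_le_of_le_one_left (norm_nonneg _) (pow_le_one₀ hr.le hr1.le)
    calc ‖it G (n + 1) z‖ ≤ r * ‖it G n z‖ := h.upper n _ h1
      _ ≤ r * (r ^ n * ‖z‖) := by gcongr
      _ = _ := by ring

theorem it_tendsto (h : Good s r δ G A) (hr : 0 < r) (hr1 : r < 1) (z : E) (hz : ‖z‖ < δ) :
    Tendsto (fun n => it G n z) atTop (𝓝 0) := by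
  apply squeeze_zero_norm (fun n => h.it_le hr hr1 n z hz)
  simpa using (tendsto_pow_atTop_nhds_zero_of_lt_one hr.le hr1).mul_const ‖z‖

theorem quad (h : Good s r δ G A) (hr : 0 < r) (hr1 : r < 1) (hδ : 0 < δ) (n : ℕ) (z : E)
    (hz : ‖z‖ < δ) : ‖G n z - A n z‖ ≤ 2 / δ * ‖z‖ ^ 2 := by
  have key := Complex.dist_le_mul_div_pow_of_mapsTo_ball_of_isLittleO (n := 1)
    (f := fun z => G n z - A n z) (c := (0 : E)) (z := z) (R₁ := δ) (R₂ := 2 * δ)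
    (((h.diff n).sub (A n).differentiable).differentiableOn) ?_ ?_ (by simpa using hz)
  · simp only [h.zero, map_zero, sub_zero, dist_zero_right] at key
    refine key.trans (le_of_eq ?_)
    rw [div_pow]
    field_simp
  · intro w hw
    simp only [mem_ball, dist_zero_right] at hw
    simp only [h.zero, map_zero, sub_zero, mem_closedBall, dist_zero_right]
    have h1 := h.upper n w hw
    have h2 := h.Aup n w
    have h3 := norm_sub_le (G n w) (A n w)
    nlinarith [norm_nonneg w]
  · have := (h.deriv n).isLittleO
    simp only [h.zero, map_zero, sub_zero, pow_one] at this ⊢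
    exact this.norm_right

theorem step (h : Good s r δ G A) (hs : 0 < s) (hr : 0 < r) (hr1 : r < 1) (hδ : 0 < δ)
    (n : ℕ) (z : E) (hz : ‖z‖ < δ) :
    ‖approx G A (n + 1) z - approx G A n z‖ ≤ 2 / δ / s * (r ^ 2 / s) ^ n * ‖z‖ ^ 2 := by
  have e : L A (n + 1) (approx G A (n + 1) z - approx G A n z) =
      G n (it G n z) - A n (it G n z) := by
    rw [map_sub]
    unfold approx
    rw [ContinuousLinearEquiv.apply_symm_apply]
    show _ - A n (L A n _) = _
    rw [ContinuousLinearEquiv.apply_symm_apply]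
    rfl
  have h1 := L_low hs h.Alow (n + 1) (approx G A (n + 1) z - approx G A n z)
  rw [e] at h1
  have h2 := h.it_le hr hr1 n z hz
  have h3 : ‖it G n z‖ < δ := by
    refine lt_of_le_of_lt (h2.trans ?_) hz
    exact mul_le_of_le_one_left (norm_nonneg _) (pow_le_one₀ hr.le hr1.le)
  have h4 := h.quad hr hr1 hδ n _ h3
  have h5 : 2 / δ * ‖it G n z‖ ^ 2 ≤ 2 / δ * (r ^ n * ‖z‖) ^ 2 := by gcongr
  have h6 := (h1.trans h4).trans h5
  rw [mul_comm, ← le_div_iff₀ (by positivity)] at h6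
  refine h6.trans (le_of_eq ?_)
  rw [div_pow]
  field_simp
  try ring

end Good

/-- Local convergence with a radius depending only on `s, r, δ`. -/
theorem exists_local [CompleteSpace E] (s r δ : ℝ) (hs : 0 < s) (hr : 0 < r) (hr1 : r < 1)
    (hr2 : r ^ 2 < s) (hδ : 0 < δ) :
    ∃ ρ : ℝ, 0 < ρ ∧ ρ ≤ δ ∧ ∀ (G : ℕ → E → E) (A : ℕ → E ≃L[ℂ] E), Good s r δ G A →
      ∃ Ψ : E → E, (∀ z ∈ ball (0 : E) ρ, Tendsto (fun n => approx G A n z) atTop (𝓝 (Ψ z))) ∧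
        DifferentiableOn ℂ Ψ (ball 0 ρ) ∧ InjOn Ψ (ball 0 ρ) ∧
        ball 0 (ρ / 4) ⊆ Ψ '' ball 0 ρ := by
  set q : ℝ := r ^ 2 / s with hq
  have hq0 : 0 ≤ q := by positivity
  have hq1 : q < 1 := by rw [hq, div_lt_one hs]; exact hr2
  set c : ℝ := 2 / δ / s with hc
  have hc0 : 0 < c := by positivity
  set K : ℝ := c * (1 - q)⁻¹ with hK
  have hK0 : 0 < K := by
    have : 0 < 1 - q := by linarith
    positivity
  set ρ : ℝ := min (δ / 2) (1 / (16 * K)) with hρ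
  have hρ0 : 0 < ρ := by
    have : 0 < δ / 2 := by positivity
    have : 0 < 1 / (16 * K) := by positivity
    exact lt_min ‹_› ‹_›
  have hρδ : ρ ≤ δ / 2 := min_le_left _ _
  have hρK : 8 * K * ρ ≤ 1 / 2 := by
    have : ρ ≤ 1 / (16 * K) := min_le_right _ _
    rw [le_div_iff₀ (by positivity)] at this
    linarith
  refine ⟨ρ, hρ0, by linarith, fun G A h => ?_⟩
  set d : ℕ → E → E := fun n z => approx G A (n + 1) z - approx G A n z with hd
  have happ : ∀ n, Differentiable ℂ (approx G A n) := fun n =>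
    (L A n).symm.differentiable.comp (h.it_diff n)
  have hdd : ∀ n, Differentiable ℂ (d n) := fun n => (happ (n + 1)).sub (happ n)
  have hdb : ∀ n z, ‖z‖ < δ → ‖d n z‖ ≤ c * q ^ n * ‖z‖ ^ 2 := fun n z hz =>
    h.step hs hr hr1 hδ n z hz
  have hgeo : HasSum (fun n : ℕ => q ^ n) (1 - q)⁻¹ := hasSum_geometric_of_lt_one hq0 hq1
  have hder : ∀ n, ∀ z ∈ ball (0 : E) ρ, ‖fderiv ℂ (d n) z‖ ≤ 8 * c * ρ * q ^ n := by
    intro n z hz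
    rw [mem_ball_zero_iff] at hz
    have hb : ∀ w, ‖w‖ < 2 * ρ → ‖d n w‖ ≤ c * q ^ n * (2 * ρ) ^ 2 := fun w hw =>
      (hdb n w (by linarith)).trans (by gcongr)
    have := Complex.norm_fderiv_le_div_of_mapsTo_ball (f := d n) (c := z) (R₁ := ρ)
      (R₂ := 2 * (c * q ^ n * (2 * ρ) ^ 2)) (hdd n).differentiableOn ?_ hρ0
    · refine this.trans (le_of_eq ?_)
      field_simp
      try ring
    · intro w hw
      rw [mem_ball, dist_eq_norm] at hw
      rw [mem_closedBall, dist_eq_norm]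
      have h1 := hb z (by linarith)
      have h2 := hb w (by
        have := norm_add_le (w - z) z
        rw [sub_add_cancel] at this
        linarith)
      have := norm_sub_le (d n w) (d n z)
      linarith
  have hsum8 : HasSum (fun n : ℕ => 8 * c * ρ * q ^ n) (8 * K * ρ) := by
    have := hgeo.mul_left (8 * c * ρ)
    have e : 8 * K * ρ = 8 * c * ρ * (1 - q)⁻¹ := by rw [hK]; ring
    rw [e]
    exact this
  have hsumd : ∀ z ∈ ball (0 : E) ρ, Summable (fun n => d n z) := by
    intro z hz
    rw [mem_ball_zero_iff] at hz
    refine Summable.of_norm_bounded (g := fun n => c * q ^ n * ‖z‖ ^ 2) ?_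
      (fun n => hdb n z (by linarith))
    exact (hgeo.summable.mul_left c).mul_right _
  have hfd : ∀ z ∈ ball (0 : E) ρ,
      HasFDerivAt (fun y => ∑' n, d n y) (∑' n, fderiv ℂ (d n) z) z := by
    intro z hz
    refine hasFDerivAt_tsum_of_isPreconnected hsum8.summable isOpen_ball ?_
      (fun n x _ => (hdd n x).hasFDerivAt) hder hz (hsumd z hz) hz
    let _ : NormedSpace ℝ E := NormedSpace.restrictScalars ℝ ℂ E
    exact (convex_ball (0 : E) ρ).isPreconnected
  have hfn : ∀ z ∈ ball (0 : E) ρ, ‖∑' n, fderiv ℂ (d n) z‖ ≤ 1 / 2 := fun z hz =>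
    (tsum_of_norm_bounded hsum8 (fun n => hder n z hz)).trans hρK
  have hlip : ∀ x ∈ ball (0 : E) ρ, ∀ y ∈ ball (0 : E) ρ,
      ‖(∑' n, d n y) - ∑' n, d n x‖ ≤ 1 / 2 * ‖y - x‖ := by
    intro x hx y hy
    let _ : NormedSpace ℝ E := NormedSpace.restrictScalars ℝ ℂ E
    exact (convex_ball (0 : E) ρ).norm_image_sub_le_of_norm_hasFDerivWithin_le
      (fun z hz => (hfd z hz).hasFDerivWithinAt) hfn hx hy
  have h0 : (∑' n, d n 0) = 0 := by
    have : ∀ n, d n 0 = 0 := fun n => by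
      have := hdb n 0 (by simpa using hδ)
      simpa using this
    simp [this]
  refine ⟨fun z => z + ∑' n, d n z, ?_, ?_, ?_, ?_⟩
  · intro z hz
    have h1 := (hsumd z hz).hasSum.tendsto_sum_nat
    have h2 : ∀ n, ∑ i ∈ Finset.range n, d i z = approx G A n z - z := by
      intro n
      rw [Finset.sum_range_sub (fun n => approx G A n z)]
      rfl
    simp only [h2] at h1
    simpa using h1.const_add z
  · intro z hz
    exact (differentiableAt_id.add (hfd z hz).differentiableAt).differentiableWithinAt
  · intro x hx y hy hxy
    have h1 := hlip x hx y hy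
    have h2 : (∑' n, d n y) - ∑' n, d n x = x - y := by
      have : x + ∑' n, d n x = y + ∑' n, d n y := hxy
      rw [sub_eq_sub_iff_add_eq_add, add_comm, ← this]
    rw [h2, norm_sub_rev] at h1
    have h3 : ‖y - x‖ = 0 := by linarith [norm_nonneg (y - x)]
    exact (sub_eq_zero.1 (norm_eq_zero.1 h3)).symm
  · have hal : ApproximatesLinearOn (fun z => z + ∑' n, d n z) (ContinuousLinearMap.id ℂ E)
        (ball (0 : E) ρ) (1 / 2 : NNReal) := by
      intro x hx y hy
      have := hlip y hy x hx
      have e : (x + ∑' n, d n x) - (y + ∑' n, d n y) - ContinuousLinearMap.id ℂ E (x - y)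
          = (∑' n, d n x) - ∑' n, d n y := by
        simp only [ContinuousLinearMap.id_apply]; abel
      show ‖(x + ∑' n, d n x) - (y + ∑' n, d n y) - ContinuousLinearMap.id ℂ E (x - y)‖ ≤ _
      rw [e]
      simpa using this
    let R : (ContinuousLinearMap.id ℂ E).NonlinearRightInverse :=
      { toFun := id, nnnorm := 1, bound' := fun y => by simp, right_inv' := fun y => rfl }
    have hsub : closedBall (0 : E) (ρ / 2) ⊆ ball 0 ρ := closedBall_subset_ball (by linarith)
    have hsurj := hal.surjOn_closedBall_of_nonlinearRightInverse R (ε := ρ / 2) (b := 0)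
      (by linarith) hsub
    intro y hy
    have hy' : y ∈ closedBall ((0 : E) + ∑' n, d n 0)
        (((R.nnnorm : ℝ)⁻¹ - ((1 / 2 : NNReal) : ℝ)) * (ρ / 2)) := by
      rw [h0, add_zero]
      refine ball_subset_closedBall.trans (closedBall_subset_closedBall (le_of_eq ?_)) hy
      show _ = (((1 : NNReal) : ℝ)⁻¹ - ((1 / 2 : NNReal) : ℝ)) * (ρ / 2)
      push_cast
      ring
    obtain ⟨x, hx, hxy⟩ := hsurj hy'
    exact ⟨x, hsub hx, hxy⟩

theorem global [CompleteSpace E] (s r δ : ℝ) (hs : 0 < s) (hr : 0 < r) (hr1 : r < 1)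
    (hr2 : r ^ 2 < s) (hδ : 0 < δ) (G : ℕ → E → E) (A : ℕ → E ≃L[ℂ] E) (h : Good s r δ G A)
    (hbij : ∀ j, Function.Bijective (G j)) :
    ∃ Φ : E → E, DifferentiableOn ℂ Φ {z | Tendsto (fun j => it G j z) atTop (𝓝 0)} ∧
      InjOn Φ {z | Tendsto (fun j => it G j z) atTop (𝓝 0)} ∧
      Φ '' {z | Tendsto (fun j => it G j z) atTop (𝓝 0)} = univ := by
  obtain ⟨ρ, hρ, hρδ, hloc⟩ := exists_local (E := E) s r δ hs hr hr1 hr2 hδ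
  choose Ψ hΨ using fun m => hloc _ _ (h.shift m)
  have hitbij : ∀ n, Function.Bijective (it G n) := by
    intro n
    induction n with
    | zero => exact Function.bijective_id
    | succ n ih => exact (hbij n).comp ih
  set Φ : E → E := fun z => limUnder atTop (fun n => approx G A n z) with hΦ
  have key : ∀ m z, it G m z ∈ ball (0 : E) ρ → Φ z = (L A m).symm (Ψ m (it G m z)) := by
    intro m z hz
    apply Tendsto.limUnder_eq
    rw [← tendsto_add_atTop_iff_nat m]
    have h1 := ((L A m).symm.continuous.tendsto _).comp ((hΨ m).1 _ hz)
    refine h1.congr fun n => ?_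
    rw [add_comm n m, approx_add]
    rfl
  have ev : ∀ z, Tendsto (fun j => it G j z) atTop (𝓝 0) →
      ∀ᶠ m in atTop, it G m z ∈ ball (0 : E) ρ := fun z hz => hz (ball_mem_nhds _ hρ)
  refine ⟨Φ, ?_, ?_, ?_⟩
  · intro z hz
    obtain ⟨m, hm⟩ := (ev z hz).exists
    apply DifferentiableAt.differentiableWithinAt
    have h1 : DifferentiableAt ℂ (fun z => (L A m).symm (Ψ m (it G m z))) z := by
      have h2 : DifferentiableAt ℂ (Ψ m) (it G m z) :=
        (hΨ m).2.1.differentiableAt (isOpen_ball.mem_nhds hm)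
      exact (L A m).symm.differentiableAt.comp z (h2.comp z (h.it_diff m z))
    refine h1.congr_of_eventuallyEq ?_
    filter_upwards [(h.it_diff m).continuous.continuousAt (isOpen_ball.mem_nhds hm)] with w hw
    exact key m w hw
  · intro x hx y hy hxy
    obtain ⟨m, hmx, hmy⟩ := ((ev x hx).and (ev y hy)).exists
    rw [key m x hmx, key m y hmy] at hxy
    exact (hitbij m).1 ((hΨ m).2.2.1 hmx hmy ((L A m).symm.injective hxy))
  · refine eq_univ_of_forall fun v => ?_
    have ht : Tendsto (fun m => L A m v) atTop (𝓝 0) := by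
      apply squeeze_zero_norm (fun n => L_up hr h.Aup n v)
      simpa using (tendsto_pow_atTop_nhds_zero_of_lt_one hr.le hr1).mul_const ‖v‖
    obtain ⟨m, hm⟩ := (ht.eventually (ball_mem_nhds _ (show 0 < ρ / 4 by linarith))).exists
    obtain ⟨u, hu, huv⟩ := (hΨ m).2.2.2 hm
    obtain ⟨z, rfl⟩ := (hitbij m).2 u
    refine ⟨z, ?_, ?_⟩
    · show Tendsto _ _ _
      rw [← tendsto_add_atTop_iff_nat m]
      have hu' : ‖it G m z‖ < δ := lt_of_lt_of_le (by simpa using hu) hρδ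
      refine ((h.shift m).it_tendsto hr hr1 _ hu').congr fun n => ?_
      rw [add_comm n m, it_add]
    · rw [key m z hu, huv, ContinuousLinearEquiv.symm_apply_apply]

theorem deriv_bounds {f : E → E} {A : E →L[ℂ] E} {s r δ : ℝ} (hδ : 0 < δ) (h0 : f 0 = 0)
    (hf : HasFDerivAt f A 0)
    (hb : ∀ z, ‖z‖ < δ → s * ‖z‖ ≤ ‖f z‖ ∧ ‖f z‖ ≤ r * ‖z‖) (v : E) :
    s * ‖v‖ ≤ ‖A v‖ ∧ ‖A v‖ ≤ r * ‖v‖ := by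
  have h1 : Tendsto (fun t : ℂ => ‖t⁻¹ • f (t • v)‖) (𝓝[≠] 0) (𝓝 ‖A v‖) := by
    have := (hf.hasLineDerivAt v).tendsto_slope_zero
    simpa [h0] using this.norm
  have h2 : ∀ᶠ t : ℂ in 𝓝[≠] 0, ‖t • v‖ < δ := by
    have : ContinuousAt (fun t : ℂ => ‖t • v‖) 0 := by fun_prop
    apply nhdsWithin_le_nhds
    exact this.eventually_lt continuousAt_const (by simpa using hδ)
  have h3 : ∀ᶠ t : ℂ in 𝓝[≠] 0, s * ‖v‖ ≤ ‖t⁻¹ • f (t • v)‖ ∧ ‖t⁻¹ • f (t • v)‖ ≤ r * ‖v‖ := by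
    filter_upwards [h2, self_mem_nhdsWithin] with t ht htn
    have htp : 0 < ‖t‖ := norm_pos_iff.2 htn
    obtain ⟨a, b⟩ := hb _ ht
    rw [norm_smul] at a b
    rw [norm_smul, norm_inv, inv_mul_eq_div, le_div_iff₀ htp, div_le_iff₀ htp]
    constructor <;> linarith
  exact ⟨ge_of_tendsto h1 (h3.mono fun _ h => h.1), le_of_tendsto h1 (h3.mono fun _ h => h.2)⟩

end FB

theorem basin_of_sequence_is_FB (k : ℕ) (hk : 2 ≤ k) (s r δ : ℝ)
    (hs : 0 < s) (hsr : s < r) (hr1 : r < 1) (hr2 : r ^ 2 < s) (hδ : 0 < δ)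
    (p : EuclideanSpace ℂ (Fin k))
    (F : ℕ → EuclideanSpace ℂ (Fin k) → EuclideanSpace ℂ (Fin k))
    (hF : ∀ j, 1 ≤ j → IsAutomorphism (F j) ∧ F j p = p ∧
      ∀ z ∈ Metric.ball p δ, s * ‖z - p‖ ≤ ‖F j z - p‖ ∧ ‖F j z - p‖ ≤ r * ‖z - p‖) :
    ∃ Φ : EuclideanSpace ℂ (Fin k) → EuclideanSpace ℂ (Fin k),
      DifferentiableOn ℂ Φ {z | Tendsto (fun j => seqComp F j z) atTop (nhds p)} ∧
      Set.InjOn Φ {z | Tendsto (fun j => seqComp F j z) atTop (nhds p)} ∧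
      Φ '' {z | Tendsto (fun j => seqComp F j z) atTop (nhds p)} = Set.univ := by
  have hr : 0 < r := hs.trans hsr
  set G : ℕ → EuclideanSpace ℂ (Fin k) → EuclideanSpace ℂ (Fin k) :=
    fun j w => F (j + 1) (w + p) - p with hG
  have hFj := fun j : ℕ => hF (j + 1) (by omega)
  have hGd : ∀ j, Differentiable ℂ (G j) := fun j =>
    ((hFj j).1.1.comp (differentiable_id.add_const p)).sub_const p
  have hG0 : ∀ j, G j 0 = 0 := fun j => by simp [hG, (hFj j).2.1]
  have hGb : ∀ j z, ‖z‖ < δ → s * ‖z‖ ≤ ‖G j z‖ ∧ ‖G j z‖ ≤ r * ‖z‖ := fun j z hz => by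
    have := (hFj j).2.2 (z + p) (by simpa [mem_ball, dist_eq_norm] using hz)
    simpa [hG] using this
  have hb := fun j => FB.deriv_bounds hδ (hG0 j) (hGd j 0).hasFDerivAt (hGb j)
  have hA : ∀ j, ∃ A : EuclideanSpace ℂ (Fin k) ≃L[ℂ] EuclideanSpace ℂ (Fin k),
      (A : EuclideanSpace ℂ (Fin k) →L[ℂ] EuclideanSpace ℂ (Fin k)) = fderiv ℂ (G j) 0 := by
    intro j
    have hinj : Function.Injective (fderiv ℂ (G j) 0).toLinearMap := by
      rw [← LinearMap.ker_eq_bot, LinearMap.ker_eq_bot']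
      intro v hv
      have h1 := (hb j v).1
      have hv' : fderiv ℂ (G j) 0 v = 0 := hv
      rw [hv', norm_zero] at h1
      have : ‖v‖ ≤ 0 := by
        by_contra hh
        push Not at hh
        have := mul_pos hs hh
        linarith
      exact norm_le_zero_iff.1 this
    refine ⟨(LinearEquiv.ofInjectiveEndo _ hinj).toContinuousLinearEquiv, ?_⟩
    ext v
    rfl
  choose A hA using hA
  have hAv : ∀ j v, A j v = fderiv ℂ (G j) 0 v := fun j v => by rw [← hA j]; rfl
  have hgood : FB.Good s r δ G A :=
    ⟨hGd, hG0, fun j z hz => (hGb j z hz).2, fun j => by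
      rw [hA j]; exact (hGd j 0).hasFDerivAt,
      fun j v => by rw [hAv]; exact (hb j v).2, fun j v => by rw [hAv]; exact (hb j v).1⟩
  have hbij : ∀ j, Function.Bijective (G j) := by
    intro j
    obtain ⟨-, H, -, hl, hri⟩ := (hFj j).1
    refine ((Equiv.subRight p).bijective.comp
      (Function.bijective_iff_has_inverse.2 ⟨H, hl, hri⟩)).comp (Equiv.addRight p).bijective
  have hit : ∀ n z, seqComp F n z = FB.it G n (z - p) + p := by
    intro n z
    induction n with
    | zero => simp [seqComp, FB.it]
    | succ n ih =>
      show F (n + 1) (seqComp F n z) = (F (n + 1) (FB.it G n (z - p) + p) - p) + p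
      rw [ih, sub_add_cancel]
  have hset : ∀ z, Tendsto (fun j => seqComp F j z) atTop (nhds p) ↔
      Tendsto (fun j => FB.it G j (z - p)) atTop (nhds 0) := by
    intro z
    simp only [hit]
    constructor
    · intro h
      simpa using h.sub_const p
    · intro h
      simpa using h.add_const p
  obtain ⟨Φ, h1, h2, h3⟩ := FB.global s r δ hs hr hr1 hr2 hδ G A hgood hbij
  refine ⟨fun z => Φ (z - p), ?_, ?_, ?_⟩
  · exact h1.comp (differentiable_id.sub_const p).differentiableOn fun z hz => (hset z).1 hz
  · intro x hx y hy hxy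
    exact sub_left_injective (h2 ((hset x).1 hx) ((hset y).1 hy) hxy)
  · refine eq_univ_of_forall fun v => ?_
    obtain ⟨z, hz, rfl⟩ := h3.symm ▸ mem_univ v
    exact ⟨z + p, (hset _).2 (by simpa using hz), by simp⟩
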